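/- arXiv:0707.3401 — 2 statements merged into one kernel-verified Lean document; each statement's English description precedes it below -/
import Mathlib

section
/- Fix τ ∈ (0,π). Let {μ_{nk}} be an infinitesimal array of probability measures on 𝕋, each with nonzero first moment, let {λ_n}_{n≥1} ⊂ 𝕋, and let B : 𝔻 → closed unit disk be an analytic function. Then λ_n · Π_{k=1}^{k_n} B_{μ_{nk}}(z) converges to B(z) uniformly on compact subsets of 𝔻 as n → ∞ if and only if exp(i·arg λ_n + i·Σ_{k=1}^{k_n} β_{nk} − Σ_{k=1}^{k_n} h_{nk}(z)) converges to B(z) uniformly on compact subsets of 𝔻 as n → ∞. -/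
open MeasureTheory Complex Filter Topology Metric

noncomputable section

instance : MeasurableSpace Circle := borel Circle
instance : BorelSpace Circle := ⟨rfl⟩

/-- ψ_μ(z) = ∫ ζz/(1-ζz) dμ(ζ). -/
def psiT (μ : Measure Circle) (z : ℂ) : ℂ :=
  ∫ ζ : Circle, ((ζ : ℂ) * z) / (1 - (ζ : ℂ) * z) ∂μ

/-- The B-transform of a measure on the circle:
B_μ(z) = (1/z)·ψ_μ(z)/(1+ψ_μ(z)) for z ≠ 0 and B_μ(0) = ∫ ζ dμ. -/
def BT (μ : Measure Circle) (z : ℂ) : ℂ :=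
  if z = 0 then ∫ ζ : Circle, (ζ : ℂ) ∂μ
  else z⁻¹ * (psiT μ z / (1 + psiT μ z))

/-- Infinitesimal triangular array: max_{1≤k≤k_n} μ_{nk}{|ζ-1| ≥ ε} → 0 as n → ∞. -/
def IsInfinitesimalArrayT (kn : ℕ → ℕ) (μ : ℕ → ℕ → Measure Circle) : Prop :=
  ∀ ε : ℝ, 0 < ε → ∀ δ : ENNReal, 0 < δ → ∃ N : ℕ, ∀ n ≥ N, ∀ i < kn n,
    μ n i {ζ : Circle | ε ≤ ‖(ζ : ℂ) - 1‖} < δ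

/-- β = ∫_{|arg ζ|<τ} arg ζ dμ. -/
def betaT (τ : ℝ) (μ : Measure Circle) : ℝ :=
  ∫ ζ in {ζ : Circle | |Complex.arg (ζ : ℂ)| < τ}, Complex.arg (ζ : ℂ) ∂μ

/-- b = e^{iβ} as an element of the circle. -/
def bT (τ : ℝ) (μ : Measure Circle) : Circle := Circle.exp (betaT τ μ)

/-- μ° : the centering of μ, i.e. the pushforward of μ under ζ ↦ b⁻¹ ζ. -/
def centerT (τ : ℝ) (μ : Measure Circle) : Measure Circle :=
  Measure.map (fun ζ => (bT τ μ)⁻¹ * ζ) μ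

/-- h(z) = -i ∫ Im ζ dμ° + ∫ (1+ζz)/(1-ζz)·(1-Re ζ) dμ°, for the centered measure μ°. -/
def hT (τ : ℝ) (μ : Measure Circle) (z : ℂ) : ℂ :=
  -Complex.I * ((∫ ζ : Circle, ((ζ : ℂ)).im ∂(centerT τ μ) : ℝ) : ℂ) +
    ∫ ζ : Circle, ((1 + (ζ : ℂ) * z) / (1 - (ζ : ℂ) * z)) * ((1 - ((ζ : ℂ)).re : ℝ) : ℂ)
      ∂(centerT τ μ)

lemma Circle.integrable_of_continuous {E : Type*} [NormedAddCommGroup E] (ν : Measure Circle)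
    [IsFiniteMeasure ν] {f : Circle → E} (hf : Continuous f) : Integrable f ν :=
  hf.integrable_of_hasCompactSupport (HasCompactSupport.of_compactSpace f)

/-- The mass `∫ (1 - Re ζ) dν`, which controls the size of `hT`. -/
def circleDefect (ν : Measure Circle) : ℝ := ∫ ζ : Circle, (1 - (ζ : ℂ).re) ∂ν

/-- The mean distance `∫ |ζ - 1| dμ` to `1`. -/
def meanDist (μ : Measure Circle) : ℝ := ∫ ζ : Circle, ‖(ζ : ℂ) - 1‖ ∂μ

/-- The integral of the Herglotz kernel against `(1 - Re ζ) dν`. -/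
def herglotzPart (ν : Measure Circle) (z : ℂ) : ℂ :=
  ∫ ζ : Circle, ((1 + (ζ : ℂ) * z) / (1 - (ζ : ℂ) * z)) * ((1 - (ζ : ℂ).re : ℝ) : ℂ) ∂ν

/-- The function `hT` as a function of the centered measure. -/
def hCentered (ν : Measure Circle) (z : ℂ) : ℂ :=
  -Complex.I * ((∫ ζ : Circle, ((ζ : ℂ)).im ∂ν : ℝ) : ℂ) + herglotzPart ν z

lemma Circle.re_le_one (ζ : Circle) : (ζ : ℂ).re ≤ 1 :=
  (Complex.re_le_norm (ζ : ℂ)).trans_eq ζ.norm_coe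

lemma circleDefect_nonneg (ν : Measure Circle) : 0 ≤ circleDefect ν :=
  integral_nonneg fun ζ => sub_nonneg.2 ζ.re_le_one

lemma one_sub_le_norm_one_sub {r : ℝ} {w : ℂ} (hw : ‖w‖ ≤ r) : 1 - r ≤ ‖1 - w‖ := by
  have := norm_sub_norm_le (1 : ℂ) w
  rw [norm_one] at this
  linarith

lemma one_sub_ne_zero_of_norm_lt {w : ℂ} (hw : ‖w‖ < 1) : 1 - w ≠ 0 := by
  have := one_sub_le_norm_one_sub le_rfl (w := w)
  exact norm_pos_iff.1 (by linarith)

lemma Circle.norm_coe_mul (ζ : Circle) (z : ℂ) : ‖(ζ : ℂ) * z‖ = ‖z‖ := by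
  rw [norm_mul, ζ.norm_coe, one_mul]

lemma Circle.one_sub_coe_mul_ne_zero {z : ℂ} (hz : ‖z‖ < 1) (ζ : Circle) :
    1 - (ζ : ℂ) * z ≠ 0 :=
  one_sub_ne_zero_of_norm_lt (by rwa [ζ.norm_coe_mul])

lemma herglotz_re_ge {r : ℝ} {w : ℂ} (hr : r < 1) (hw : ‖w‖ ≤ r) :
    (1 - r) / (1 + r) ≤ ((1 + w) / (1 - w)).re := by
  have hr0 : 0 ≤ r := (norm_nonneg w).trans hw
  have hne : 1 - w ≠ 0 := one_sub_ne_zero_of_norm_lt (hw.trans_lt hr)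
  have hp : 0 < Complex.normSq (1 - w) := Complex.normSq_pos.2 hne
  have hw2 : w.re ^ 2 + w.im ^ 2 ≤ r ^ 2 := by
    have h := Complex.sq_norm w
    rw [Complex.normSq_apply] at h
    nlinarith [norm_nonneg w]
  have hre : -r ≤ w.re := by
    have := (abs_le.1 (Complex.abs_re_le_norm w)).1
    linarith
  have h1 : ((1 + w) / (1 - w)).re = (1 - (w.re ^ 2 + w.im ^ 2)) / Complex.normSq (1 - w) := by
    rw [Complex.div_re]
    field_simp
    simp
    ring
  rw [h1, div_le_div_iff₀ (by linarith) hp, Complex.normSq_apply]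
  simp
  nlinarith [mul_nonneg hr0 (sub_nonneg.2 hw2)]

lemma norm_herglotz_le {r : ℝ} {w : ℂ} (hr : r < 1) (hw : ‖w‖ ≤ r) :
    ‖(1 + w) / (1 - w)‖ ≤ 2 / (1 - r) := by
  rw [norm_div]
  have h1 := one_sub_le_norm_one_sub hw
  have h2 := norm_add_le (1 : ℂ) w
  rw [norm_one] at h2
  have : 0 < 1 - r := by linarith
  gcongr
  linarith

lemma norm_herglotz_sub_le {r : ℝ} {w v : ℂ} (hr : r < 1) (hw : ‖w‖ ≤ r) (hv : ‖v‖ ≤ r) :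
    ‖(1 + w) / (1 - w) - (1 + v) / (1 - v)‖ ≤ 2 / (1 - r) ^ 2 * ‖w - v‖ := by
  have hw0 : 1 - w ≠ 0 := one_sub_ne_zero_of_norm_lt (hw.trans_lt hr)
  have hv0 : 1 - v ≠ 0 := one_sub_ne_zero_of_norm_lt (hv.trans_lt hr)
  have : (1 + w) / (1 - w) - (1 + v) / (1 - v) = 2 * (w - v) / ((1 - w) * (1 - v)) := by
    field_simp
    ring
  rw [this, norm_div, norm_mul, norm_mul, Complex.norm_ofNat, div_mul_eq_mul_div]
  have h1 := one_sub_le_norm_one_sub hw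
  have h2 := one_sub_le_norm_one_sub hv
  have h3 : 0 < 1 - r := by linarith
  gcongr
  rw [sq]
  gcongr

lemma continuous_herglotz_kernel {z : ℂ} (hz : ‖z‖ < 1) :
    Continuous fun ζ : Circle =>
      ((1 + (ζ : ℂ) * z) / (1 - (ζ : ℂ) * z)) * ((1 - (ζ : ℂ).re : ℝ) : ℂ) := by
  have := Circle.one_sub_coe_mul_ne_zero hz
  fun_prop (disch := assumption)

lemma continuous_one_sub_re : Continuous fun ζ : Circle => 1 - (ζ : ℂ).re := by
  fun_prop

lemma le_re_herglotzPart (ν : Measure Circle) [IsFiniteMeasure ν] {r : ℝ} (hr : r < 1) {z : ℂ}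
    (hz : ‖z‖ ≤ r) : (1 - r) / (1 + r) * circleDefect ν ≤ (herglotzPart ν z).re := by
  have hint := Circle.integrable_of_continuous ν (continuous_herglotz_kernel (hz.trans_lt hr))
  have h := integral_re hint
  simp only [RCLike.re_to_complex] at h
  rw [herglotzPart, ← h, circleDefect, ← integral_const_mul]
  refine integral_mono ((Circle.integrable_of_continuous ν continuous_one_sub_re).const_mul _)
    hint.re fun ζ => ?_
  simp only [Complex.re_mul_ofReal]
  exact mul_le_mul_of_nonneg_right (herglotz_re_ge hr (by rwa [ζ.norm_coe_mul]))
    (sub_nonneg.2 ζ.re_le_one)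

lemma norm_herglotzPart_le (ν : Measure Circle) [IsFiniteMeasure ν] {r : ℝ} (hr : r < 1) {z : ℂ}
    (hz : ‖z‖ ≤ r) : ‖herglotzPart ν z‖ ≤ 2 / (1 - r) * circleDefect ν := by
  rw [herglotzPart, circleDefect, ← integral_const_mul]
  refine norm_integral_le_of_norm_le
    ((Circle.integrable_of_continuous ν continuous_one_sub_re).const_mul _) (ae_of_all _ fun ζ => ?_)
  rw [norm_mul, Complex.norm_of_nonneg (sub_nonneg.2 ζ.re_le_one)]
  exact mul_le_mul_of_nonneg_right (norm_herglotz_le hr (by rwa [ζ.norm_coe_mul]))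
    (sub_nonneg.2 ζ.re_le_one)

lemma norm_herglotzPart_sub_le (ν : Measure Circle) [IsFiniteMeasure ν] {r : ℝ} (hr : r < 1)
    {z w : ℂ} (hz : ‖z‖ ≤ r) (hw : ‖w‖ ≤ r) :
    ‖herglotzPart ν z - herglotzPart ν w‖ ≤ 2 / (1 - r) ^ 2 * ‖z - w‖ * circleDefect ν := by
  rw [herglotzPart, herglotzPart, ← integral_sub
    (Circle.integrable_of_continuous ν (continuous_herglotz_kernel (hz.trans_lt hr)))
    (Circle.integrable_of_continuous ν (continuous_herglotz_kernel (hw.trans_lt hr))),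
    circleDefect, ← integral_const_mul]
  refine norm_integral_le_of_norm_le
    ((Circle.integrable_of_continuous ν continuous_one_sub_re).const_mul _) (ae_of_all _ fun ζ => ?_)
  rw [← sub_mul, norm_mul, Complex.norm_of_nonneg (sub_nonneg.2 ζ.re_le_one)]
  refine mul_le_mul_of_nonneg_right ?_ (sub_nonneg.2 ζ.re_le_one)
  have h := norm_herglotz_sub_le hr (w := ζ * z) (v := ζ * w) (by rwa [ζ.norm_coe_mul])
    (by rwa [ζ.norm_coe_mul])
  rwa [← mul_sub, ζ.norm_coe_mul] at h

lemma re_hCentered (ν : Measure Circle) (z : ℂ) :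
    (hCentered ν z).re = (herglotzPart ν z).re := by
  simp [hCentered]

lemma BT_eq_div (ν : Measure Circle) [IsProbabilityMeasure ν] {z : ℂ} (hz : ‖z‖ < 1) :
    BT ν z = (∫ ζ : Circle, (ζ : ℂ) / (1 - ζ * z) ∂ν) / ∫ ζ : Circle, 1 / (1 - (ζ : ℂ) * z) ∂ν := by
  have hne := Circle.one_sub_coe_mul_ne_zero hz
  by_cases h0 : z = 0
  · simp [BT, h0]
  have h1 : psiT ν z = z * ∫ ζ : Circle, (ζ : ℂ) / (1 - ζ * z) ∂ν := by
    rw [psiT, ← integral_const_mul]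
    congr 1 with ζ
    ring
  have h2 : 1 + psiT ν z = ∫ ζ : Circle, 1 / (1 - (ζ : ℂ) * z) ∂ν := by
    have : (1 : ℂ) = ∫ _ : Circle, (1 : ℂ) ∂ν := by simp
    rw [psiT]
    nth_rewrite 1 [this]
    rw [← integral_add (integrable_const _)]
    · congr 1 with ζ
      have := hne ζ
      field_simp
      ring
    · refine Circle.integrable_of_continuous ν ?_
      fun_prop (disch := assumption)
  rw [BT, if_neg h0, h2, h1, mul_div_assoc, inv_mul_cancel_left₀ h0]

lemma herglotz_kernel_identity {w z : ℂ} (hw : ‖w‖ = 1) (hne : 1 - w * z ≠ 0) :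
    -Complex.I * (w.im : ℂ) + (1 + w * z) / (1 - w * z) * ((1 - w.re : ℝ) : ℂ) =
      (1 - z) * (1 / (1 - w * z) - w / (1 - w * z)) := by
  have hn : w * (w.re - w.im * Complex.I) = 1 := by
    have h1 := Complex.mul_conj w
    rw [Complex.normSq_eq_norm_sq, hw] at h1
    have h2 : (starRingEnd ℂ) w = w.re - w.im * Complex.I := by
      apply Complex.ext <;> simp
    rw [h2] at h1
    simpa using h1
  have hx : w = w.re + w.im * Complex.I := (Complex.re_add_im _).symm
  push_cast
  generalize ((w.re : ℝ) : ℂ) = x at *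
  generalize ((w.im : ℝ) : ℂ) = y at *
  field_simp
  linear_combination hx - z * hn

lemma hCentered_eq (ν : Measure Circle) [IsProbabilityMeasure ν] {z : ℂ} (hz : ‖z‖ < 1) :
    hCentered ν z = (1 - z) * ((∫ ζ : Circle, 1 / (1 - (ζ : ℂ) * z) ∂ν) -
      ∫ ζ : Circle, (ζ : ℂ) / (1 - ζ * z) ∂ν) := by
  have hne := Circle.one_sub_coe_mul_ne_zero hz
  rw [hCentered, herglotzPart, ← integral_complex_ofReal, ← integral_const_mul, ← integral_add,
    ← integral_sub, ← integral_const_mul]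
  · congr 1 with ζ
    exact herglotz_kernel_identity ζ.norm_coe (hne ζ)
  all_goals
    refine Circle.integrable_of_continuous ν ?_
    fun_prop (disch := assumption)

lemma BT_eq_one_sub (ν : Measure Circle) [IsProbabilityMeasure ν] {z : ℂ} (hz : ‖z‖ < 1)
    (hne : 1 - z * hCentered ν z / (1 - z) ≠ 0) :
    BT ν z = 1 - hCentered ν z / (1 - z * hCentered ν z / (1 - z)) := by
  have hz0 : 1 - z ≠ 0 := one_sub_ne_zero_of_norm_lt hz
  have hk := Circle.one_sub_coe_mul_ne_zero hz
  have hQ : (∫ ζ : Circle, 1 / (1 - (ζ : ℂ) * z) ∂ν) -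
      z * ∫ ζ : Circle, (ζ : ℂ) / (1 - ζ * z) ∂ν = 1 := by
    rw [← integral_const_mul, ← integral_sub]
    · rw [integral_congr_ae (g := fun _ => (1 : ℂ)) (ae_of_all _ fun ζ => ?_)]
      · simp
      · have := hk ζ
        field_simp
    all_goals
      refine Circle.integrable_of_continuous ν ?_
      fun_prop (disch := assumption)
  rw [hCentered_eq ν hz] at hne ⊢
  rw [BT_eq_div ν hz]
  generalize (∫ ζ : Circle, 1 / (1 - (ζ : ℂ) * z) ∂ν) = Q at *
  generalize (∫ ζ : Circle, (ζ : ℂ) / (1 - ζ * z) ∂ν) = P at *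
  have h1 : 1 - z * ((1 - z) * (Q - P)) / (1 - z) = (1 - z) * Q := by
    field_simp
    linear_combination -hQ
  rw [h1] at hne ⊢
  have hQ0 : Q ≠ 0 := right_ne_zero_of_mul hne
  field_simp
  ring

lemma norm_BT_sub_le (ν : Measure Circle) [IsProbabilityMeasure ν] {r : ℝ} (hr : r < 1) {z : ℂ}
    (hz : ‖z‖ ≤ r) (hs : ‖hCentered ν z‖ ≤ (1 - r) / 2) :
    ‖BT ν z - (1 - hCentered ν z)‖ ≤ 2 / (1 - r) * ‖hCentered ν z‖ ^ 2 := by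
  have hr' : 0 < 1 - r := by linarith
  set h := hCentered ν z with hh
  have hw : ‖z * h / (1 - z)‖ ≤ ‖h‖ / (1 - r) := by
    rw [norm_div, norm_mul]
    have h1 := one_sub_le_norm_one_sub hz
    have : ‖z‖ * ‖h‖ ≤ ‖h‖ := mul_le_of_le_one_left (norm_nonneg _) (by linarith)
    gcongr
  have hw2 : ‖z * h / (1 - z)‖ ≤ 1 / 2 := by
    refine hw.trans ?_
    rw [div_le_iff₀ hr']
    linarith
  have hne := one_sub_ne_zero_of_norm_lt (hw2.trans_lt (by norm_num))
  rw [BT_eq_one_sub ν (hz.trans_lt hr) hne, ← hh]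
  have h3 := one_sub_le_norm_one_sub hw2
  set w := z * h / (1 - z)
  have h4 : 1 - h / (1 - w) - (1 - h) = -(h * w / (1 - w)) := by
    field_simp
    ring
  rw [h4, norm_neg, norm_div, norm_mul]
  calc ‖h‖ * ‖w‖ / ‖1 - w‖ ≤ ‖h‖ * (‖h‖ / (1 - r)) / (1 / 2) := by
        gcongr
        linarith
    _ = _ := by ring

lemma Real.abs_sin_sub_le_two_mul_sq (u : ℝ) : |Real.sin u - u| ≤ 2 * u ^ 2 := by
  rcases le_total |u| 1 with h | h
  · have h1 := Real.sin_bound h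
    have h2 : |Real.sin u - u| ≤ |Real.sin u - (u - u ^ 3 / 6)| + |u| ^ 3 / 6 := by
      have h3 : |u ^ 3 / 6| = |u| ^ 3 / 6 := by rw [abs_div, abs_pow]; norm_num
      rw [← h3, ← abs_neg (u ^ 3 / 6)]
      refine le_trans (le_of_eq ?_) (abs_add_le _ _)
      ring_nf
    have h4 : |u| ^ 3 ≤ |u| ^ 2 := pow_le_pow_of_le_one (abs_nonneg _) h (by norm_num)
    have h5 : |u| ^ 5 ≤ |u| ^ 2 := pow_le_pow_of_le_one (abs_nonneg _) h (by norm_num)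
    rw [← sq_abs u]
    nlinarith [sq_nonneg |u|]
  · have h1 : |Real.sin u - u| ≤ |Real.sin u| + |u| := abs_sub _ _
    have h2 := Real.abs_sin_le_one u
    rw [← sq_abs u]
    nlinarith

lemma Real.two_mul_sq_le_mul_one_sub_cos {u : ℝ} (hu : |u| ≤ Real.pi) :
    2 * u ^ 2 ≤ 20 * (1 - Real.cos u) := by
  have h := Real.cos_le_one_sub_mul_cos_sq hu
  have hp : Real.pi ^ 2 ≤ 20 := by nlinarith [Real.pi_le_four, Real.pi_lt_d2, Real.pi_pos]
  have hp0 : 0 < Real.pi ^ 2 := by positivity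
  have h2 : 2 / 20 * u ^ 2 ≤ 2 / Real.pi ^ 2 * u ^ 2 := by gcongr
  linarith

lemma Circle.abs_arg_le (ζ : Circle) : |Complex.arg (ζ : ℂ)| ≤ 2 * ‖(ζ : ℂ) - 1‖ := by
  set θ := Complex.arg (ζ : ℂ) with hθ
  have hζ : (ζ : ℂ) = Complex.exp (θ * Complex.I) := by
    rw [← Circle.coe_exp, hθ, Circle.exp_arg]
  have hn : ‖(ζ : ℂ) - 1‖ ^ 2 = 2 * (1 - Real.cos θ) := by
    rw [hζ, Complex.sq_norm, Complex.normSq_apply]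
    simp only [Complex.sub_re, Complex.sub_im, Complex.exp_ofReal_mul_I_re,
      Complex.exp_ofReal_mul_I_im, Complex.one_re, Complex.one_im]
    nlinarith [Real.sin_sq_add_cos_sq θ]
  have h := Real.cos_le_one_sub_mul_cos_sq (Complex.abs_arg_le_pi (ζ : ℂ))
  rw [← hθ] at h
  have hp : Real.pi ^ 2 ≤ 16 := by nlinarith [Real.pi_le_four, Real.pi_pos]
  have hp0 : 0 < Real.pi ^ 2 := by positivity
  have h2 : 2 / 16 * θ ^ 2 ≤ 2 / Real.pi ^ 2 * θ ^ 2 := by gcongr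
  refine abs_le_of_sq_le_sq ?_ (by positivity)
  nlinarith

instance isProbabilityMeasure_centerT (τ : ℝ) (μ : Measure Circle) [IsProbabilityMeasure μ] :
    IsProbabilityMeasure (centerT τ μ) :=
  Measure.isProbabilityMeasure_map (by fun_prop)

lemma integral_centerT (τ : ℝ) (μ : Measure Circle) {E : Type*} [NormedAddCommGroup E]
    [NormedSpace ℝ E] [SecondCountableTopology E] {f : Circle → E} (hf : Continuous f) :
    ∫ ζ, f ζ ∂(centerT τ μ) = ∫ ζ, f ((bT τ μ)⁻¹ * ζ) ∂μ :=
  integral_map (by fun_prop) (hf.stronglyMeasurable).aestronglyMeasurable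

lemma BT_eq_BT_centerT (τ : ℝ) (μ : Measure Circle) [IsProbabilityMeasure μ] {z : ℂ}
    (hz : ‖z‖ < 1) : BT μ z = bT τ μ * BT (centerT τ μ) (bT τ μ * z) := by
  have hz' : ‖(bT τ μ : ℂ) * z‖ < 1 := by rwa [Circle.norm_coe_mul]
  have hne := Circle.one_sub_coe_mul_ne_zero hz'
  rw [BT_eq_div μ hz, BT_eq_div _ hz', integral_centerT, integral_centerT, ← mul_div_assoc,
    ← integral_const_mul]
  · have hc : ∀ ζ : Circle, (((bT τ μ)⁻¹ * ζ : Circle) : ℂ) * (bT τ μ * z) = ζ * z := fun ζ => by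
      have h0 := Circle.coe_ne_zero (bT τ μ)
      rw [Circle.coe_mul, Circle.coe_inv]
      field_simp
    simp only [hc]
    congr 2 with ζ
    have h0 := Circle.coe_ne_zero (bT τ μ)
    rw [Circle.coe_mul, Circle.coe_inv]
    field_simp
  all_goals fun_prop (disch := assumption)

lemma Circle.measurable_coe : Measurable fun ζ : Circle => (ζ : ℂ) :=
  Continuous.measurable (by fun_prop)

lemma measurableSet_abs_arg_lt (τ : ℝ) :
    MeasurableSet {ζ : Circle | |Complex.arg (ζ : ℂ)| < τ} := by
  have h : Measurable fun ζ : Circle => |Complex.arg (ζ : ℂ)| := by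
    have h2 : Measurable fun ζ : Circle => Complex.arg (ζ : ℂ) :=
      Complex.measurable_arg.comp Circle.measurable_coe
    exact continuous_abs.measurable.comp h2
  exact measurableSet_lt h measurable_const

lemma integrable_circle_arg (μ : Measure Circle) [IsFiniteMeasure μ] :
    Integrable (fun ζ : Circle => Complex.arg (ζ : ℂ)) μ :=
  Integrable.of_bound
    (Complex.measurable_arg.comp Circle.measurable_coe).aestronglyMeasurable Real.pi
    (ae_of_all _ fun _ => Complex.abs_arg_le_pi _)

lemma meanDist_nonneg (μ : Measure Circle) : 0 ≤ meanDist μ :=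
  integral_nonneg fun _ => norm_nonneg _

lemma abs_betaT_le (τ : ℝ) (μ : Measure Circle) [IsFiniteMeasure μ] :
    |betaT τ μ| ≤ 2 * meanDist μ := by
  rw [betaT, ← integral_indicator (measurableSet_abs_arg_lt τ), meanDist, ← integral_const_mul]
  have hint : Integrable (fun ζ : Circle => 2 * ‖(ζ : ℂ) - 1‖) μ :=
    Circle.integrable_of_continuous μ (by fun_prop)
  rw [← Real.norm_eq_abs]
  refine norm_integral_le_of_norm_le hint (ae_of_all _ fun ζ => ?_)
  exact (norm_indicator_le_norm_self _ _).trans ζ.abs_arg_le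

lemma norm_bT_sub_one_le (τ : ℝ) (μ : Measure Circle) : ‖(bT τ μ : ℂ) - 1‖ ≤ |betaT τ μ| := by
  have h := Real.norm_exp_I_mul_ofReal_sub_one_le (x := betaT τ μ)
  rwa [mul_comm, ← Circle.coe_exp] at h

lemma circleDefect_centerT_le (τ : ℝ) (μ : Measure Circle) [IsProbabilityMeasure μ] :
    circleDefect (centerT τ μ) ≤ 3 * meanDist μ := by
  rw [circleDefect, integral_centerT τ μ continuous_one_sub_re]
  have h : ∀ ζ : Circle, 1 - (((bT τ μ)⁻¹ * ζ : Circle) : ℂ).re ≤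
      ‖(ζ : ℂ) - 1‖ + |betaT τ μ| := fun ζ => by
    set b := bT τ μ with hb
    have h1 : (1 - ((b⁻¹ * ζ : Circle) : ℂ)).re ≤ ‖1 - ((b⁻¹ * ζ : Circle) : ℂ)‖ :=
      Complex.re_le_norm _
    have h2 : (b : ℂ) * (1 - ((b⁻¹ * ζ : Circle) : ℂ)) = (b - 1) - (ζ - 1) := by
      have h0 := Circle.coe_ne_zero b
      rw [Circle.coe_mul, Circle.coe_inv]
      field_simp
      ring
    have h3 : ‖1 - ((b⁻¹ * ζ : Circle) : ℂ)‖ = ‖((b : ℂ) - 1) - (ζ - 1)‖ := by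
      rw [← h2, b.norm_coe_mul]
    have h4 := norm_sub_le ((b : ℂ) - 1) (ζ - 1)
    have h5 := norm_bT_sub_one_le τ μ
    rw [Complex.sub_re, Complex.one_re] at h1
    rw [← hb] at h5
    linarith
  have h1 : Integrable (fun ζ : Circle => ‖(ζ : ℂ) - 1‖ + |betaT τ μ|) μ :=
    Circle.integrable_of_continuous μ (by fun_prop)
  have h2 : Integrable (fun ζ : Circle => ‖(ζ : ℂ) - 1‖) μ :=
    Circle.integrable_of_continuous μ (by fun_prop)
  calc _ ≤ ∫ ζ : Circle, (‖(ζ : ℂ) - 1‖ + |betaT τ μ|) ∂μ :=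
        integral_mono (Circle.integrable_of_continuous μ (by fun_prop)) h1 h
    _ = meanDist μ + |betaT τ μ| := by
        rw [integral_add h2 (integrable_const _), meanDist]
        simp
    _ ≤ _ := by linarith [abs_betaT_le τ μ]

lemma Real.one_sub_cos_half_le {τ θ β : ℝ} (hτ : 0 < τ) (hβ : |β| ≤ τ / 2) (hθ : τ ≤ |θ|)
    (hθ' : |θ| ≤ Real.pi) : 1 - Real.cos (τ / 2) ≤ 1 - Real.cos (θ - β) := by
  have h1 : τ / 2 ≤ |θ - β| := by linarith [abs_sub_abs_le_abs_sub θ β]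
  have h2 : |θ - β| ≤ Real.pi + τ / 2 := by linarith [abs_sub θ β]
  rw [← Real.cos_abs (θ - β)]
  rcases le_total |θ - β| Real.pi with h | h
  · linarith [Real.cos_le_cos_of_nonneg_of_le_pi (by linarith) h h1]
  · have h3 : Real.cos (2 * Real.pi - |θ - β|) ≤ Real.cos (τ / 2) :=
      Real.cos_le_cos_of_nonneg_of_le_pi (by linarith) (by linarith) (by linarith)
    rw [Real.cos_two_pi_sub] at h3
    linarith

/-- The constant in the bound of `∫ Im ζ dμ°` by `∫ (1 - Re ζ) dμ°`. -/
def imBound (τ : ℝ) : ℝ := 20 + 2 / (1 - Real.cos (τ / 2))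

lemma one_sub_cos_half_pos {τ : ℝ} (hτ : 0 < τ) (hτ' : τ < Real.pi) :
    0 < 1 - Real.cos (τ / 2) := by
  have := Real.cos_lt_cos_of_nonneg_of_le_pi le_rfl (by linarith : τ / 2 ≤ Real.pi) (by linarith)
  rw [Real.cos_zero] at this
  linarith

lemma imBound_nonneg {τ : ℝ} (hτ : 0 < τ) (hτ' : τ < Real.pi) : 0 ≤ imBound τ := by
  have := one_sub_cos_half_pos hτ hτ'
  rw [imBound]
  positivity

lemma abs_integral_im_centerT_le {τ : ℝ} (hτ : 0 < τ) (hτ' : τ < Real.pi) (μ : Measure Circle)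
    [IsProbabilityMeasure μ] (h1 : |betaT τ μ| ≤ 1) (h2 : |betaT τ μ| ≤ τ / 2)
    (h3 : |betaT τ μ| ≤ Real.pi - τ) :
    |∫ ζ : Circle, (ζ : ℂ).im ∂(centerT τ μ)| ≤ imBound τ * circleDefect (centerT τ μ) := by
  have hc := one_sub_cos_half_pos hτ hτ'
  set S := {ζ : Circle | |Complex.arg (ζ : ℂ)| < τ} with hS
  have hSm : MeasurableSet S := measurableSet_abs_arg_lt τ
  have hexp : ∀ ζ : Circle, (((bT τ μ)⁻¹ * ζ : Circle) : ℂ) =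
      Complex.exp ((Complex.arg (ζ : ℂ) - betaT τ μ : ℝ) * Complex.I) := fun ζ => by
    rw [← Circle.coe_exp, Circle.exp_sub, Circle.exp_arg, bT, div_eq_inv_mul]
  have hI : Integrable (S.indicator fun ζ : Circle => Complex.arg (ζ : ℂ)) μ :=
    (integrable_circle_arg μ).indicator hSm
  have hI1 : Integrable (fun ζ : Circle => (((bT τ μ)⁻¹ * ζ : Circle) : ℂ).im) μ :=
    Circle.integrable_of_continuous μ (by fun_prop)
  have hI2 : Integrable (fun ζ : Circle => (((bT τ μ)⁻¹ * ζ : Circle) : ℂ).im -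
      S.indicator (fun ζ : Circle => Complex.arg (ζ : ℂ)) ζ) μ := hI1.sub hI
  have hm : ∫ ζ : Circle, (ζ : ℂ).im ∂(centerT τ μ) = ∫ ζ : Circle,
      ((((bT τ μ)⁻¹ * ζ : Circle) : ℂ).im - S.indicator (fun ζ : Circle => Complex.arg (ζ : ℂ)) ζ
        + betaT τ μ) ∂μ := by
    rw [integral_add hI2 (integrable_const _), integral_sub hI1 hI,
      integral_indicator hSm, integral_centerT τ μ (by fun_prop)]
    simp [betaT, hS]
  rw [hm, circleDefect, integral_centerT τ μ continuous_one_sub_re, ← integral_const_mul]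
  have hint : Integrable (fun ζ : Circle =>
      imBound τ * (1 - (((bT τ μ)⁻¹ * ζ : Circle) : ℂ).re)) μ :=
    Circle.integrable_of_continuous μ (by fun_prop)
  rw [← Real.norm_eq_abs]
  refine norm_integral_le_of_norm_le hint (ae_of_all _ fun ζ => ?_)
  rw [hexp, Complex.exp_ofReal_mul_I_re, Complex.exp_ofReal_mul_I_im, Real.norm_eq_abs, imBound,
    add_mul]
  set θ := Complex.arg (ζ : ℂ) with hθ
  have hcos : 0 ≤ 1 - Real.cos (θ - betaT τ μ) := sub_nonneg.2 (Real.cos_le_one _)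
  by_cases hζ : ζ ∈ S
  · rw [Set.indicator_of_mem hζ]
    have h4 : |θ - betaT τ μ| ≤ Real.pi := by
      have : |θ| < τ := hζ
      linarith [abs_sub θ (betaT τ μ)]
    have h5 := Real.abs_sin_sub_le_two_mul_sq (θ - betaT τ μ)
    have h6 := Real.two_mul_sq_le_mul_one_sub_cos h4
    have h7 : 0 ≤ 2 / (1 - Real.cos (τ / 2)) * (1 - Real.cos (θ - betaT τ μ)) := by positivity
    rw [sub_sub_eq_add_sub, add_sub_right_comm] at h5
    linarith
  · rw [Set.indicator_of_notMem hζ, sub_zero]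
    have h4 : τ ≤ |θ| := not_lt.1 hζ
    have h5 := Real.one_sub_cos_half_le hτ h2 h4 (Complex.abs_arg_le_pi _)
    have h6 : 2 ≤ 2 / (1 - Real.cos (τ / 2)) * (1 - Real.cos (θ - betaT τ μ)) := by
      rw [div_mul_eq_mul_div, le_div_iff₀ hc]
      linarith
    have h7 := abs_add_le (Real.sin (θ - betaT τ μ)) (betaT τ μ)
    have h8 := Real.abs_sin_le_one (θ - betaT τ μ)
    linarith

lemma meanDist_le (μ : Measure Circle) [IsProbabilityMeasure μ] {ε : ℝ} (hε : 0 < ε)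
    (h : μ {ζ : Circle | ε ≤ ‖(ζ : ℂ) - 1‖} ≤ ENNReal.ofReal ε) : meanDist μ ≤ 3 * ε := by
  set S := {ζ : Circle | ε ≤ ‖(ζ : ℂ) - 1‖} with hS
  have hSm : MeasurableSet S := (isClosed_le continuous_const (by fun_prop)).measurableSet
  have hreal : μ.real S ≤ ε := ENNReal.toReal_le_of_le_ofReal hε.le h
  have hI : Integrable (S.indicator fun _ : Circle => (2 : ℝ)) μ :=
    (integrable_const _).indicator hSm
  calc meanDist μ ≤ ∫ ζ : Circle, (ε + S.indicator (fun _ => (2 : ℝ)) ζ) ∂μ := by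
        refine integral_mono (Circle.integrable_of_continuous μ (by fun_prop))
          ((integrable_const _).add hI) fun ζ => ?_
        by_cases hζ : ζ ∈ S
        · simp only [Set.indicator_of_mem hζ]
          have := norm_sub_le (ζ : ℂ) 1
          rw [ζ.norm_coe, norm_one] at this
          linarith
        · simp only [Set.indicator_of_notMem hζ, add_zero]
          exact (not_le.1 hζ).le
    _ = ε + 2 * μ.real S := by
        rw [integral_add (integrable_const _) hI, integral_indicator hSm]
        simp [mul_comm]
    _ ≤ 3 * ε := by linarith

lemma norm_prod_sub_prod_le {ι : Type*} (s : Finset ι) (x y : ι → ℂ) (a : ι → ℝ) {c ε : ℝ}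
    (hc : 0 ≤ c) (hε : 0 ≤ ε) (ha : ∀ i ∈ s, 0 ≤ a i) (ha1 : ∀ i ∈ s, a i ≤ 1)
    (hx : ∀ i ∈ s, ‖x i‖ ≤ Real.exp (-c * a i)) (hy : ∀ i ∈ s, ‖y i‖ ≤ Real.exp (-c * a i))
    (hxy : ∀ i ∈ s, ‖x i - y i‖ ≤ ε * a i) :
    ‖∏ i ∈ s, x i - ∏ i ∈ s, y i‖ ≤
      ε * Real.exp c * ((∑ i ∈ s, a i) * Real.exp (-c * ∑ i ∈ s, a i)) := by
  classical
  induction s using Finset.induction_on with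
  | empty => simp
  | insert j s hj ih =>
    simp only [Finset.forall_mem_insert] at ha ha1 hx hy hxy
    have h1 := ih ha.2 ha1.2 hx.2 hy.2 hxy.2
    have h2 : ‖∏ i ∈ s, x i‖ ≤ Real.exp (-c * ∑ i ∈ s, a i) := by
      rw [norm_prod, Finset.mul_sum, Real.exp_sum]
      exact Finset.prod_le_prod (fun _ _ => norm_nonneg _) hx.2
    rw [Finset.prod_insert hj, Finset.prod_insert hj, Finset.sum_insert hj]
    set A := ∑ i ∈ s, a i
    set X := ∏ i ∈ s, x i
    set Y := ∏ i ∈ s, y i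
    have h3 : x j * X - y j * Y = (x j - y j) * X + y j * (X - Y) := by ring
    have h4 : 1 ≤ Real.exp c * Real.exp (-c * a j) := by
      rw [← Real.exp_add]
      refine Real.one_le_exp ?_
      nlinarith [ha1.1]
    have h5 : Real.exp (-c * (a j + A)) = Real.exp (-c * a j) * Real.exp (-c * A) := by
      rw [← Real.exp_add]
      ring_nf
    rw [h3, h5]
    calc _ ≤ ‖x j - y j‖ * ‖X‖ + ‖y j‖ * ‖X - Y‖ := by
          refine (norm_add_le _ _).trans ?_
          rw [norm_mul, norm_mul]
      _ ≤ ε * a j * Real.exp (-c * A) * 1 +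
          Real.exp (-c * a j) * (ε * Real.exp c * (A * Real.exp (-c * A))) := by
          rw [mul_one]
          have := ha.1
          gcongr
          exacts [hxy.1, hy.1]
      _ ≤ ε * a j * Real.exp (-c * A) * (Real.exp c * Real.exp (-c * a j)) +
          Real.exp (-c * a j) * (ε * Real.exp c * (A * Real.exp (-c * A))) := by
          have := ha.1
          gcongr
      _ = _ := by ring

lemma mul_exp_neg_mul_le {c : ℝ} (hc : 0 < c) (A : ℝ) : A * Real.exp (-c * A) ≤ 1 / c := by
  have h := Real.add_one_le_exp (c * A)
  rw [le_div_iff₀ hc, neg_mul, Real.exp_neg, mul_right_comm, mul_inv_le_iff₀ (Real.exp_pos _)]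
  linarith

lemma exp_neg_add_le_exp_neg_half {c a δ : ℝ} (hc : 0 ≤ c) (hc1 : c ≤ 1) (ha : 0 ≤ a)
    (ha1 : a ≤ 1) (hδ : δ ≤ Real.exp (-1) * (c / 2)) :
    Real.exp (-c * a) + δ * a ≤ Real.exp (-(c / 2) * a) := by
  have h1 : Real.exp (-(c / 2) * a) = Real.exp (-c * a) * Real.exp (c / 2 * a) := by
    rw [← Real.exp_add]
    ring_nf
  have h2 := Real.add_one_le_exp (c / 2 * a)
  have h3 : Real.exp (-1) ≤ Real.exp (-c * a) := Real.exp_le_exp.2 (by nlinarith)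
  rw [h1]
  have h4 : Real.exp (-1) * (c / 2 * a) ≤ Real.exp (-c * a) * (c / 2 * a) := by gcongr
  nlinarith [Real.exp_pos (-c * a)]

/-- For a measure close to the unit mass at `1`, the factors of the two products are close,
relative to the defect of the centered measure, and both decay exponentially in the defect. -/
lemma exists_factor_estimate {τ r : ℝ} (hτ : 0 < τ) (hτ' : τ < Real.pi) (hr0 : 0 ≤ r)
    (hr : r < 1) : ∃ c > 0, ∃ C ≥ 0, ∃ s₀ > 0, ∀ μ : Measure Circle, IsProbabilityMeasure μ →
      meanDist μ < s₀ → ∀ z : ℂ, ‖z‖ ≤ r →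
        circleDefect (centerT τ μ) ≤ 1 ∧
        ‖BT (centerT τ μ) (bT τ μ * z)‖ ≤ Real.exp (-c * circleDefect (centerT τ μ)) ∧
        ‖Complex.exp (-hT τ μ z)‖ ≤ Real.exp (-c * circleDefect (centerT τ μ)) ∧
        ‖BT (centerT τ μ) (bT τ μ * z) - Complex.exp (-hT τ μ z)‖ ≤
          C * meanDist μ * circleDefect (centerT τ μ) := by
  have hr' : 0 < 1 - r := by linarith
  set c := (1 - r) / (1 + r) with hc
  have hc0 : 0 < c := by positivity
  have hc1 : c ≤ 1 := by
    rw [hc, div_le_one (by linarith)]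
    linarith
  set H := imBound τ + 2 / (1 - r) with hH
  have hH0 : 0 ≤ H := add_nonneg (imBound_nonneg hτ hτ') (by positivity)
  set C := 6 * H ^ 2 / (1 - r) + 4 / (1 - r) ^ 2 + 3 * H ^ 2 with hC
  have hC0 : 0 ≤ C := by positivity
  have hev : ∀ k d : ℝ, 0 < d → ∀ᶠ s : ℝ in 𝓝 0, k * s < d := fun k d hd => by
    have : Tendsto (fun s : ℝ => k * s) (𝓝 0) (𝓝 0) :=
      Continuous.tendsto' (by fun_prop) _ _ (mul_zero k)
    exact this.eventually (gt_mem_nhds hd)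
  obtain ⟨s₀, hs₀, hsmall⟩ := Metric.eventually_nhds_iff.1 <|
    (hev 2 1 one_pos).and <| (hev 2 (τ / 2) (by linarith)).and <|
    (hev 2 (Real.pi - τ) (by linarith)).and <| (hev 3 1 one_pos).and <|
    (hev (H * 3) ((1 - r) / 2) (by linarith)).and
    (hev C (Real.exp (-1) * (c / 2)) (by positivity))
  refine ⟨c / 2, by positivity, C, hC0, s₀, hs₀, fun μ hμ hs z hz => ?_⟩
  have hm0 := meanDist_nonneg μ
  obtain ⟨e1, e2, e3, e4, e5, e6⟩ := hsmall (y := meanDist μ) (by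
    rwa [Real.dist_eq, sub_zero, abs_of_nonneg hm0])
  have hβ := abs_betaT_le τ μ
  have him := abs_integral_im_centerT_le hτ hτ' μ (by linarith) (by linarith) (by linarith)
  have ha3 := circleDefect_centerT_le τ μ
  have hb := (norm_bT_sub_one_le τ μ).trans hβ
  change _ ∧ _ ∧ ‖Complex.exp (-hCentered (centerT τ μ) z)‖ ≤ _ ∧
    ‖_ - Complex.exp (-hCentered (centerT τ μ) z)‖ ≤ _
  have ha0 := circleDefect_nonneg (centerT τ μ)
  set ν := centerT τ μ
  set a := circleDefect ν
  set s := meanDist μ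
  set b := bT τ μ
  have ha1 : a ≤ 1 := by linarith
  have hh : ∀ w : ℂ, ‖w‖ ≤ r → ‖hCentered ν w‖ ≤ H * a := fun w hw => by
    refine (norm_add_le _ _).trans ?_
    rw [hH, add_mul]
    refine add_le_add ?_ (norm_herglotzPart_le ν hr hw)
    rw [norm_mul, norm_neg, Complex.norm_I, one_mul, Complex.norm_real]
    exact him
  have hHa : H * a ≤ (1 - r) / 2 := by nlinarith
  have hbz : ‖(b : ℂ) * z‖ ≤ r := by rwa [Circle.norm_coe_mul]
  have hasq : a ^ 2 ≤ 3 * s * a := by nlinarith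
  have hsq : ∀ w : ℂ, ‖w‖ ≤ r → ‖hCentered ν w‖ ^ 2 ≤ 3 * H ^ 2 * s * a := fun w hw =>
    calc ‖hCentered ν w‖ ^ 2 ≤ (H * a) ^ 2 := by
          have := hh w hw
          gcongr
      _ = H ^ 2 * a ^ 2 := by ring
      _ ≤ H ^ 2 * (3 * s * a) := by gcongr
      _ = _ := by ring
  have hX := norm_BT_sub_le ν hr hbz ((hh _ hbz).trans hHa)
  have hX' : 2 / (1 - r) * ‖hCentered ν (b * z)‖ ^ 2 ≤ 6 * H ^ 2 / (1 - r) * s * a :=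
    calc _ ≤ 2 / (1 - r) * (3 * H ^ 2 * s * a) := by
          have := hsq _ hbz
          gcongr
      _ = _ := by ring
  have hM : ‖hCentered ν (b * z) - hCentered ν z‖ ≤ 4 / (1 - r) ^ 2 * s * a := by
    rw [hCentered, hCentered, add_sub_add_left_eq_sub]
    refine (norm_herglotzPart_sub_le ν hr hbz hz).trans ?_
    have h1 : ‖(b : ℂ) * z - z‖ ≤ 2 * s := by
      rw [← sub_one_mul, norm_mul]
      exact (mul_le_of_le_one_right (norm_nonneg _) (by linarith)).trans hb
    calc _ ≤ 2 / (1 - r) ^ 2 * (2 * s) * a := by gcongr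
      _ = _ := by ring
  have hY := Complex.norm_exp_sub_one_sub_id_le (x := -hCentered ν z) (by
    rw [norm_neg]
    linarith [hh z hz])
  rw [norm_neg] at hY
  have hexp : ‖Complex.exp (-hCentered ν z)‖ ≤ Real.exp (-c * a) := by
    rw [Complex.norm_exp, Real.exp_le_exp, Complex.neg_re, re_hCentered, neg_mul]
    exact neg_le_neg (le_re_herglotzPart ν hr hz)
  have hdiff : ‖BT ν (b * z) - Complex.exp (-hCentered ν z)‖ ≤ C * s * a := by
    set X := BT ν (b * z)
    set h₁ := hCentered ν (b * z)
    set h₂ := hCentered ν z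
    have h1 : X - Complex.exp (-h₂) =
        (X - (1 - h₁)) - (h₁ - h₂) - (Complex.exp (-h₂) - 1 - -h₂) := by ring
    have h2 := norm_sub_le (X - (1 - h₁) - (h₁ - h₂)) (Complex.exp (-h₂) - 1 - -h₂)
    have h3 := norm_sub_le (X - (1 - h₁)) (h₁ - h₂)
    have h4 : C * s * a = 6 * H ^ 2 / (1 - r) * s * a + 4 / (1 - r) ^ 2 * s * a +
        3 * H ^ 2 * s * a := by
      rw [hC]
      ring
    rw [h1, h4]
    linarith [hsq z hz]
  have hhalf := exp_neg_add_le_exp_neg_half hc0.le hc1 ha0 ha1 e6.le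
  refine ⟨ha1, ?_, hexp.trans ?_, hdiff⟩
  · have h1 := norm_sub_norm_le (BT ν (b * z)) (Complex.exp (-hCentered ν z))
    linarith
  · refine le_trans ?_ hhalf
    have : 0 ≤ C * s * a := by positivity
    linarith

lemma IsInfinitesimalArrayT.eventually_meanDist_lt {kn : ℕ → ℕ} {μ : ℕ → ℕ → Measure Circle}
    (hinf : IsInfinitesimalArrayT kn μ) (hprob : ∀ n i, IsProbabilityMeasure (μ n i)) {ε : ℝ}
    (hε : 0 < ε) : ∀ᶠ n in atTop, ∀ i < kn n, meanDist (μ n i) < ε := by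
  obtain ⟨N, hN⟩ := hinf (ε / 4) (by positivity) (ENNReal.ofReal (ε / 4)) (by simpa using hε)
  filter_upwards [eventually_ge_atTop N] with n hn i hi
  have := hprob n i
  linarith [meanDist_le (μ n i) (by positivity) (hN n hn i hi).le]

lemma Circle.exp_I_mul_arg (ζ : Circle) : Complex.exp (Complex.I * Complex.arg (ζ : ℂ)) = ζ := by
  rw [mul_comm, ← Circle.coe_exp, Circle.exp_arg]

lemma coe_bT (τ : ℝ) (μ : Measure Circle) :
    (bT τ μ : ℂ) = Complex.exp (Complex.I * betaT τ μ) := by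
  rw [bT, Circle.coe_exp, mul_comm]

lemma exp_sum_eq_mul_prod (τ : ℝ) (l : Circle) (s : Finset ℕ) (μ : ℕ → Measure Circle) (z : ℂ) :
    Complex.exp (Complex.I * (Complex.arg (l : ℂ))
      + Complex.I * ((∑ i ∈ s, betaT τ (μ i) : ℝ) : ℂ) - ∑ i ∈ s, hT τ (μ i) z) =
    l * ((∏ i ∈ s, (bT τ (μ i) : ℂ)) * ∏ i ∈ s, Complex.exp (-hT τ (μ i) z)) := by
  simp only [coe_bT]
  rw [← Complex.exp_sum, ← Complex.exp_sum, sub_eq_add_neg, Complex.exp_add, Complex.exp_add,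
    l.exp_I_mul_arg, Finset.sum_neg_distrib, mul_assoc, ← Finset.mul_sum]
  push_cast
  rfl

lemma mul_prod_BT_eq (τ : ℝ) (l : ℂ) (s : Finset ℕ) (μ : ℕ → Measure Circle)
    (hprob : ∀ i, IsProbabilityMeasure (μ i)) {z : ℂ} (hz : ‖z‖ < 1) :
    l * ∏ i ∈ s, BT (μ i) z = l * ((∏ i ∈ s, (bT τ (μ i) : ℂ)) *
      ∏ i ∈ s, BT (centerT τ (μ i)) (bT τ (μ i) * z)) := by
  rw [← Finset.prod_mul_distrib]
  congr 1
  exact Finset.prod_congr rfl fun i _ => BT_eq_BT_centerT τ (μ i) hz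

/-- The difference of the two sequences tends to zero uniformly on smaller disks. -/
lemma eventually_norm_mul_prod_BT_sub_exp_lt {τ : ℝ} (hτ : 0 < τ) (hτ' : τ < Real.pi)
    {kn : ℕ → ℕ} {μ : ℕ → ℕ → Measure Circle} (hprob : ∀ n i, IsProbabilityMeasure (μ n i))
    (hinf : IsInfinitesimalArrayT kn μ) (lam : ℕ → Circle) {r : ℝ} (hr0 : 0 ≤ r) (hr : r < 1)
    {ε : ℝ} (hε : 0 < ε) : ∀ᶠ n in atTop, ∀ z : ℂ, ‖z‖ ≤ r →
      ‖(lam n : ℂ) * ∏ i ∈ Finset.range (kn n), BT (μ n i) z -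
        Complex.exp (Complex.I * (Complex.arg (lam n : ℂ))
            + Complex.I * ((∑ i ∈ Finset.range (kn n), betaT τ (μ n i) : ℝ) : ℂ)
            - ∑ i ∈ Finset.range (kn n), hT τ (μ n i) z)‖ < ε := by
  obtain ⟨c, hc, C, hC, s₀, hs₀, hest⟩ := exists_factor_estimate hτ hτ' hr0 hr
  obtain ⟨s₁, hs₁, hs₁ε⟩ : ∃ s₁ > 0, C * s₁ * Real.exp c * (1 / c) < ε := by
    have : Tendsto (fun s : ℝ => C * s * Real.exp c * (1 / c)) (𝓝[>] 0) (𝓝 0) :=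
      (Continuous.tendsto' (by fun_prop) _ _ (by simp)).mono_left nhdsWithin_le_nhds
    exact ((eventually_mem_nhdsWithin).and (this.eventually (gt_mem_nhds hε))).exists
  filter_upwards [hinf.eventually_meanDist_lt hprob hs₀, hinf.eventually_meanDist_lt hprob hs₁]
    with n hn₀ hn₁ z hz
  have hest' : ∀ i ∈ Finset.range (kn n), _ := fun i hi =>
    hest (μ n i) (hprob n i) (hn₀ i (Finset.mem_range.1 hi)) z hz
  rw [exp_sum_eq_mul_prod, mul_prod_BT_eq τ _ _ _ (hprob n) (hz.trans_lt hr), ← mul_sub,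
    ← mul_sub, norm_mul, norm_mul, Circle.norm_coe, norm_prod]
  simp only [Circle.norm_coe, Finset.prod_const_one, one_mul]
  refine lt_of_le_of_lt (norm_prod_sub_prod_le _ _ _ (fun i => circleDefect (centerT τ (μ n i)))
    hc.le (by positivity : 0 ≤ C * s₁) (fun i _ => circleDefect_nonneg _)
    (fun i hi => (hest' i hi).1) (fun i hi => (hest' i hi).2.1) (fun i hi => (hest' i hi).2.2.1)
    fun i hi => (hest' i hi).2.2.2.trans ?_) (lt_of_le_of_lt ?_ hs₁ε)
  · have h1 := (hn₁ i (Finset.mem_range.1 hi)).le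
    have h2 := circleDefect_nonneg (centerT τ (μ n i))
    gcongr
  · have h1 := mul_exp_neg_mul_le hc
    gcongr
    exact h1 _

lemma IsCompact.exists_norm_le_of_subset_ball {K : Set ℂ} (hK : IsCompact K)
    (hKb : K ⊆ ball (0 : ℂ) 1) : ∃ r, 0 ≤ r ∧ r < 1 ∧ ∀ z ∈ K, ‖z‖ ≤ r := by
  rcases K.eq_empty_or_nonempty with rfl | hne
  · exact ⟨0, le_rfl, one_pos, by simp⟩
  · obtain ⟨w, hw, hmax⟩ := hK.exists_isMaxOn hne continuous_norm.continuousOn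
    exact ⟨‖w‖, norm_nonneg _, by simpa using hKb hw, fun z hz => hmax hz⟩

lemma TendstoUniformlyOn.of_norm_sub_lt {F G : ℕ → ℂ → ℂ} {B : ℂ → ℂ} {K : Set ℂ}
    (hF : TendstoUniformlyOn F B atTop K)
    (h : ∀ ε > 0, ∀ᶠ n in atTop, ∀ z ∈ K, ‖F n z - G n z‖ < ε) :
    TendstoUniformlyOn G B atTop K := by
  rw [Metric.tendstoUniformlyOn_iff] at hF ⊢
  intro ε hε
  filter_upwards [hF (ε / 2) (by positivity), h (ε / 2) (by positivity)] with n h1 h2 z hz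
  have h3 := dist_triangle (B z) (F n z) (G n z)
  rw [dist_eq_norm (F n z)] at h3
  linarith [h1 z hz, h2 z hz]

/-- Proposition 3.2: λ_n·Π_k B_{μ_{nk}}(z) → B(z) uniformly on compacts of 𝔻 iff
exp(i arg λ_n + i Σ_k β_{nk} − Σ_k h_{nk}(z)) → B(z) uniformly on compacts of 𝔻. -/
theorem stmt2
    (τ : ℝ) (hτ : 0 < τ ∧ τ < Real.pi)
    (kn : ℕ → ℕ) (μ : ℕ → ℕ → Measure Circle)
    (hprob : ∀ n i, IsProbabilityMeasure (μ n i))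
    (hinf : IsInfinitesimalArrayT kn μ)
    (hmom : ∀ n : ℕ, ∀ i < kn n, (∫ ζ : Circle, (ζ : ℂ) ∂(μ n i)) ≠ 0)
    (lam : ℕ → Circle)
    (B : ℂ → ℂ)
    (hB_anal : DifferentiableOn ℂ B (ball (0:ℂ) 1))
    (hB_bdd : ∀ z ∈ ball (0:ℂ) 1, ‖B z‖ ≤ 1) :
    (∀ K : Set ℂ, K ⊆ ball (0:ℂ) 1 → IsCompact K →
      TendstoUniformlyOn
        (fun n z => ((lam n : ℂ)) * ∏ i ∈ Finset.range (kn n), BT (μ n i) z)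
        B atTop K) ↔
    (∀ K : Set ℂ, K ⊆ ball (0:ℂ) 1 → IsCompact K →
      TendstoUniformlyOn
        (fun n z => Complex.exp (Complex.I * (Complex.arg (lam n : ℂ))
            + Complex.I * ((∑ i ∈ Finset.range (kn n), betaT τ (μ n i) : ℝ) : ℂ)
            - ∑ i ∈ Finset.range (kn n), hT τ (μ n i) z))
        B atTop K) := by
  constructor <;> intro h K hKb hK <;>
    obtain ⟨r, hr0, hr, hKr⟩ := hK.exists_norm_le_of_subset_ball hKb <;>
    refine (h K hKb hK).of_norm_sub_lt fun ε hε => ?_ <;>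
    filter_upwards [eventually_norm_mul_prod_BT_sub_exp_lt hτ.1 hτ.2 hprob hinf lam hr0 hr hε]
      with n hn z hz
  · exact hn z (hKr z hz)
  · rw [norm_sub_rev]
    exact hn z (hKr z hz)

end
end

section
/- Let {ν_n}_{n≥1} be Borel probability measures on 𝕋 such that for every n, the function B_{ν_n} is either identically zero on 𝔻 or has no zeros in 𝔻 (i.e., each ν_n is ⨃-infinitely divisible). If ν_n converges weakly to a Borel probability measure ν, then B_ν is either identically zero on 𝔻 or has no zeros in 𝔻 (i.e., ν is ⨃-infinitely divisible). -/
open MeasureTheory Complex Filter Topology Metric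

noncomputable section

/-- The Cauchy-type transform `∫ ζ/(1-ζz) dμ(ζ)`, which equals `ψ_μ(z)/z` for `z ≠ 0`. -/
def chiT (μ : Measure Circle) (z : ℂ) : ℂ :=
  ∫ ζ : Circle, (ζ : ℂ) / (1 - (ζ : ℂ) * z) ∂μ

lemma one_sub_norm_le_norm_one_sub_mul (ζ : Circle) (z : ℂ) : 1 - ‖z‖ ≤ ‖1 - (ζ : ℂ) * z‖ := by
  have := norm_sub_norm_le (1 : ℂ) ((ζ : ℂ) * z)
  rwa [norm_one, norm_mul, Circle.norm_coe, one_mul] at this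

lemma one_sub_mul_ne_zero (ζ : Circle) {z : ℂ} (hz : ‖z‖ < 1) : 1 - (ζ : ℂ) * z ≠ 0 := by
  have := one_sub_norm_le_norm_one_sub_mul ζ z
  exact norm_pos_iff.1 (by linarith)

lemma norm_coe_div_one_sub_mul_le (ζ : Circle) {z : ℂ} {r : ℝ} (hr : r < 1) (hz : ‖z‖ ≤ r) :
    ‖(ζ : ℂ) / (1 - (ζ : ℂ) * z)‖ ≤ (1 - r)⁻¹ := by
  have := one_sub_norm_le_norm_one_sub_mul ζ z
  rw [norm_div, Circle.norm_coe, one_div]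
  exact inv_anti₀ (by linarith) (by linarith)

lemma continuous_coe_div_one_sub_mul {z : ℂ} (hz : ‖z‖ < 1) :
    Continuous fun ζ : Circle => (ζ : ℂ) / (1 - (ζ : ℂ) * z) :=
  Continuous.div (by fun_prop) (by fun_prop) fun ζ => one_sub_mul_ne_zero ζ hz

lemma Continuous.integrable_circle {f : Circle → ℂ} (hf : Continuous f) (μ : Measure Circle)
    [IsFiniteMeasure μ] : Integrable f μ :=
  hf.integrable_of_hasCompactSupport (HasCompactSupport.of_compactSpace f)

lemma psiT_eq_mul_chiT (μ : Measure Circle) (z : ℂ) : psiT μ z = z * chiT μ z := by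
  rw [psiT, chiT, ← integral_const_mul]
  congr 1
  ext ζ
  ring

lemma half_le_re_inv_one_sub {w : ℂ} (hw : ‖w‖ < 1) : 1 / 2 ≤ ((1 - w)⁻¹).re := by
  have hne : 1 - w ≠ 0 := by
    rw [sub_ne_zero]
    rintro rfl
    simp at hw
  have hsq : w.re * w.re + w.im * w.im < 1 := by
    rw [← normSq_apply, normSq_eq_norm_sq]
    nlinarith [norm_nonneg w]
  rw [inv_re, div_le_div_iff₀ two_pos (normSq_pos.2 hne), normSq_apply]
  simp only [sub_re, one_re, sub_im, one_im]
  nlinarith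

lemma one_add_psiT_ne_zero (μ : Measure Circle) [IsProbabilityMeasure μ] {z : ℂ} (hz : ‖z‖ < 1) :
    1 + psiT μ z ≠ 0 := by
  have hcont : Continuous fun ζ : Circle => (1 - (ζ : ℂ) * z)⁻¹ :=
    Continuous.inv₀ (by fun_prop) fun ζ => one_sub_mul_ne_zero ζ hz
  have hint := hcont.integrable_circle μ
  have heq : 1 + psiT μ z = ∫ ζ : Circle, (1 - (ζ : ℂ) * z)⁻¹ ∂μ := by
    have hpsi : Integrable (fun ζ : Circle => (ζ : ℂ) * z / (1 - (ζ : ℂ) * z)) μ :=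
      Continuous.integrable_circle
        (Continuous.div (by fun_prop) (by fun_prop) fun ζ => one_sub_mul_ne_zero ζ hz) μ
    have hadd := integral_add (integrable_const (1 : ℂ)) hpsi
    rw [integral_const, probReal_univ, one_smul] at hadd
    rw [psiT, ← hadd]
    congr 1
    ext ζ
    have := one_sub_mul_ne_zero ζ hz
    field_simp
    ring
  have hre : 1 / 2 ≤ (1 + psiT μ z).re := by
    have hcomm := reCLM.integral_comp_comm hint
    simp only [reCLM_apply] at hcomm
    rw [heq, ← hcomm]
    calc (1 / 2 : ℝ) = ∫ _ : Circle, (1 / 2 : ℝ) ∂μ := by simp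
      _ ≤ _ := integral_mono (integrable_const _) hint.re fun ζ =>
          half_le_re_inv_one_sub (by rwa [norm_mul, Circle.norm_coe, one_mul])
  intro h
  rw [h, zero_re] at hre
  norm_num at hre

lemma BT_eq_chiT_div (μ : Measure Circle) (z : ℂ) : BT μ z = chiT μ z / (1 + psiT μ z) := by
  rw [BT]
  split_ifs with h
  · simp [h, chiT, psiT]
  · rw [psiT_eq_mul_chiT]
    field_simp

lemma BT_eq_zero_iff (μ : Measure Circle) [IsProbabilityMeasure μ] {z : ℂ} (hz : ‖z‖ < 1) :
    BT μ z = 0 ↔ chiT μ z = 0 := by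
  simp [BT_eq_chiT_div, one_add_psiT_ne_zero μ hz]

lemma norm_chiT_sub_le (μ : Measure Circle) [IsProbabilityMeasure μ] {r : ℝ} (hr : r < 1)
    {z w : ℂ} (hz : ‖z‖ ≤ r) (hw : ‖w‖ ≤ r) :
    ‖chiT μ z - chiT μ w‖ ≤ (1 - r)⁻¹ * (1 - r)⁻¹ * ‖z - w‖ := by
  have hz1 := hz.trans_lt hr
  have hw1 := hw.trans_lt hr
  rw [chiT, chiT, ← integral_sub ((continuous_coe_div_one_sub_mul hz1).integrable_circle μ)
    ((continuous_coe_div_one_sub_mul hw1).integrable_circle μ)]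
  refine (norm_integral_le_of_norm_le_const (.of_forall fun ζ => ?_)).trans_eq
    (by rw [probReal_univ, mul_one])
  have heq : (ζ : ℂ) / (1 - (ζ : ℂ) * z) - (ζ : ℂ) / (1 - (ζ : ℂ) * w) =
      (ζ : ℂ) / (1 - (ζ : ℂ) * z) * ((ζ : ℂ) / (1 - (ζ : ℂ) * w)) * (z - w) := by
    have := one_sub_mul_ne_zero ζ hz1
    have := one_sub_mul_ne_zero ζ hw1
    field_simp
    ring
  rw [heq, norm_mul, norm_mul]
  gcongr
  · exact norm_coe_div_one_sub_mul_le ζ hr hz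
  · exact norm_coe_div_one_sub_mul_le ζ hr hw

lemma differentiableOn_chiT (μ : Measure Circle) [IsProbabilityMeasure μ] :
    DifferentiableOn ℂ (chiT μ) (ball 0 1) := by
  intro z hz
  rw [mem_ball_zero_iff] at hz
  obtain ⟨r, hzr, hr⟩ := exists_between hz
  refine (hasDerivAt_integral_of_dominated_loc_of_deriv_le
    (F := fun z (ζ : Circle) => (ζ : ℂ) / (1 - (ζ : ℂ) * z))
    (F' := fun z (ζ : Circle) => ((ζ : ℂ) / (1 - (ζ : ℂ) * z)) ^ 2)
    (bound := fun _ => (1 - r)⁻¹ ^ 2) (s := ball 0 r)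
    (isOpen_ball.mem_nhds (by simpa using hzr)) ?_
    ((continuous_coe_div_one_sub_mul hz).integrable_circle μ)
    ((continuous_coe_div_one_sub_mul hz).pow 2).aestronglyMeasurable ?_ (integrable_const _)
    ?_).2.differentiableAt.differentiableWithinAt
  · filter_upwards [isOpen_ball.mem_nhds (mem_ball_zero_iff.2 hz)] with w hw
    exact (continuous_coe_div_one_sub_mul (mem_ball_zero_iff.1 hw)).aestronglyMeasurable
  · refine .of_forall fun ζ w hw => ?_
    rw [norm_pow]
    gcongr
    exact norm_coe_div_one_sub_mul_le ζ hr (mem_ball_zero_iff.1 hw).le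
  · refine .of_forall fun ζ w hw => ?_
    have hne := one_sub_mul_ne_zero ζ ((mem_ball_zero_iff.1 hw).trans hr)
    have hden : HasDerivAt (fun w : ℂ => 1 - (ζ : ℂ) * w) (-(ζ : ℂ)) w := by
      simpa using ((hasDerivAt_id w).const_mul (ζ : ℂ)).const_sub 1
    refine ((hasDerivAt_const w (ζ : ℂ)).div hden hne).congr_deriv ?_
    field_simp
    ring

lemma tendsto_integral_complex_of_real {ι : Type*} {l : Filter ι} {ν : ι → Measure Circle}
    {νlim : Measure Circle} [∀ n, IsFiniteMeasure (ν n)] [IsFiniteMeasure νlim]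
    (hweak : ∀ f : C(Circle, ℝ), Tendsto (fun n => ∫ ζ, f ζ ∂(ν n)) l (𝓝 (∫ ζ, f ζ ∂νlim)))
    {f : Circle → ℂ} (hf : Continuous f) :
    Tendsto (fun n => ∫ ζ, f ζ ∂(ν n)) l (𝓝 (∫ ζ, f ζ ∂νlim)) := by
  have heq : ∀ (μ : Measure Circle) [IsFiniteMeasure μ], ∫ ζ, f ζ ∂μ =
      ((∫ ζ, (f ζ).re ∂μ : ℝ) : ℂ) + ((∫ ζ, (f ζ).im ∂μ : ℝ) : ℂ) * I := fun μ _ =>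
    (integral_re_add_im (hf.integrable_circle μ)).symm
  simp only [heq]
  have hre := hweak ⟨fun ζ => (f ζ).re, by fun_prop⟩
  have him := hweak ⟨fun ζ => (f ζ).im, by fun_prop⟩
  exact ((continuous_ofReal.tendsto _).comp hre).add
    (((continuous_ofReal.tendsto _).comp him).mul_const I)

/-- Weak convergence gives locally uniform convergence of the transforms on the unit disk. -/
lemma tendstoLocallyUniformlyOn_chiT {ι : Type*} {l : Filter ι} {ν : ι → Measure Circle}
    {νlim : Measure Circle} [∀ n, IsProbabilityMeasure (ν n)] [IsProbabilityMeasure νlim]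
    (hweak : ∀ f : C(Circle, ℝ), Tendsto (fun n => ∫ ζ, f ζ ∂(ν n)) l (𝓝 (∫ ζ, f ζ ∂νlim))) :
    TendstoLocallyUniformlyOn (fun n => chiT (ν n)) (chiT νlim) l (ball 0 1) := by
  rw [Metric.tendstoLocallyUniformlyOn_iff]
  intro ε hε z hz
  rw [mem_ball_zero_iff] at hz
  obtain ⟨r, hzr, hr⟩ := exists_between hz
  set L : ℝ := (1 - r)⁻¹ * (1 - r)⁻¹
  have hL0 : 0 < L := by
    have : 0 < 1 - r := by linarith
    positivity
  refine ⟨ball 0 r ∩ ball z (ε / 3 / L), mem_nhdsWithin_of_mem_nhds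
    (inter_mem (isOpen_ball.mem_nhds (by simpa using hzr)) (ball_mem_nhds _ (by positivity))), ?_⟩
  have hpt : Tendsto (fun n => chiT (ν n) z) l (𝓝 (chiT νlim z)) :=
    tendsto_integral_complex_of_real hweak (continuous_coe_div_one_sub_mul hz)
  filter_upwards [Metric.tendsto_nhds.1 hpt (ε / 3) (by positivity)] with n hn w hw
  have hwr : ‖w‖ ≤ r := (mem_ball_zero_iff.1 hw.1).le
  have hwz : L * dist w z < ε / 3 := by
    have := (lt_div_iff₀ hL0).1 (mem_ball.1 hw.2)
    linarith
  have h₁ : dist (chiT νlim w) (chiT νlim z) ≤ L * dist w z := by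
    simpa only [dist_eq_norm] using norm_chiT_sub_le νlim hr hwr hzr.le
  have h₂ : dist (chiT (ν n) w) (chiT (ν n) z) ≤ L * dist w z := by
    simpa only [dist_eq_norm] using norm_chiT_sub_le (ν n) hr hwr hzr.le
  have h₃ := dist_triangle4 (chiT νlim w) (chiT νlim z) (chiT (ν n) z) (chiT (ν n) w)
  rw [dist_comm (chiT νlim z), dist_comm (chiT (ν n) z) (chiT (ν n) w)] at h₃
  linarith

/-- Minimum modulus principle on a disk for a nonvanishing holomorphic function. -/
lemma le_norm_of_forall_sphere_le_norm {f : ℂ → ℂ} {z : ℂ} {r δ : ℝ} (hr : 0 < r) (hδ : 0 < δ)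
    (hf : DifferentiableOn ℂ f (closedBall z r)) (hne : ∀ w ∈ closedBall z r, f w ≠ 0)
    (hle : ∀ w ∈ sphere z r, δ ≤ ‖f w‖) : δ ≤ ‖f z‖ := by
  have hd : DiffContOnCl ℂ (fun w => (f w)⁻¹) (ball z r) :=
    (hf.inv hne).diffContOnCl_ball subset_rfl
  have h : ‖(f z)⁻¹‖ ≤ δ⁻¹ := by
    refine norm_le_of_forall_mem_frontier_norm_le isBounded_ball hd (fun w hw => ?_)
      (subset_closure (mem_ball_self hr))
    rw [frontier_ball z hr.ne'] at hw
    rw [norm_inv]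
    exact inv_anti₀ hδ (hle w hw)
  rw [norm_inv] at h
  exact (inv_le_inv₀ (norm_pos_iff.2 (hne z (mem_closedBall_self hr.le))) hδ).1 h

/-- Hurwitz's theorem: a locally uniform limit of holomorphic functions, each of which is
identically zero or nonvanishing, is identically zero or nonvanishing. -/
lemma eq_zero_or_ne_zero_of_tendstoLocallyUniformlyOn {ι : Type*} {l : Filter ι} [l.NeBot]
    {F : ι → ℂ → ℂ} {f : ℂ → ℂ} {U : Set ℂ} (hU : IsOpen U) (hUc : IsPreconnected U)
    (hF : ∀ n, DifferentiableOn ℂ (F n) U) (hlim : TendstoLocallyUniformlyOn F f l U)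
    (hzero : ∀ n, (∀ z ∈ U, F n z = 0) ∨ ∀ z ∈ U, F n z ≠ 0) :
    (∀ z ∈ U, f z = 0) ∨ ∀ z ∈ U, f z ≠ 0 := by
  rw [or_iff_not_imp_right]
  intro hex
  push Not at hex
  obtain ⟨z₀, hz₀, hfz₀⟩ := hex
  have hf : DifferentiableOn ℂ f U := hlim.differentiableOn (.of_forall hF) hU
  refine (hf.analyticOnNhd hU).eqOn_zero_of_preconnected_of_frequently_eq_zero hUc hz₀
    fun hev => ?_
  rw [eventually_nhdsWithin_iff, Metric.eventually_nhds_iff_ball] at hev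
  obtain ⟨ρ, hρ, hρne⟩ := hev
  obtain ⟨σ, hσ, hσU⟩ := Metric.isOpen_iff.1 hU z₀ hz₀
  obtain ⟨r, hr, hrlt⟩ := exists_between (lt_min hρ hσ)
  have hcU : closedBall z₀ r ⊆ U :=
    (closedBall_subset_ball (hrlt.trans_le (min_le_right _ _))).trans hσU
  have hsU := sphere_subset_closedBall.trans hcU
  have hne : ∀ w ∈ sphere z₀ r, f w ≠ 0 := fun w hw =>
    hρne w (by rw [mem_ball, mem_sphere.1 hw]; exact hrlt.trans_le (min_le_left _ _))
      (ne_of_mem_sphere hw hr.ne')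
  obtain ⟨w₀, hw₀, hmin⟩ := (isCompact_sphere z₀ r).exists_isMinOn
    (NormedSpace.sphere_nonempty.2 hr.le) (hf.continuousOn.mono hsU).norm
  have hδ : 0 < ‖f w₀‖ / 2 := half_pos (norm_pos_iff.2 (hne w₀ hw₀))
  have hunif := (tendstoLocallyUniformlyOn_iff_forall_isCompact hU).1 hlim _ hcU
    (isCompact_closedBall z₀ r)
  obtain ⟨n, hn⟩ := (Metric.tendstoUniformlyOn_iff.1 hunif _ hδ).exists
  have hle : ∀ w ∈ sphere z₀ r, ‖f w₀‖ / 2 ≤ ‖F n w‖ := fun w hw => by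
    have h₁ := hn w (sphere_subset_closedBall hw)
    have h₂ : ‖f w₀‖ ≤ ‖f w‖ := hmin hw
    have h₃ := norm_sub_norm_le (f w) (F n w)
    rw [dist_eq_norm] at h₁
    linarith
  have hFn : ∀ z ∈ U, F n z ≠ 0 := (hzero n).resolve_left fun h => by
    have := hle w₀ hw₀
    rw [h w₀ (hsU hw₀), norm_zero] at this
    linarith
  have hcenter := le_norm_of_forall_sphere_le_norm hr hδ ((hF n).mono hcU)
    (fun w hw => hFn w (hcU hw)) hle
  have := hn z₀ (mem_closedBall_self hr.le)
  rw [hfz₀, dist_zero_left] at this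
  linarith

/-- Lemma 3.3: a weak limit of ⨃-infinitely divisible measures (those whose B-transform
is identically zero or nonvanishing on 𝔻) is again ⨃-infinitely divisible. -/
theorem stmt3
    (ν : ℕ → Measure Circle) (νlim : Measure Circle)
    (hprob : ∀ n, IsProbabilityMeasure (ν n))
    (hlimprob : IsProbabilityMeasure νlim)
    (hID : ∀ n, (∀ z ∈ ball (0:ℂ) 1, BT (ν n) z = 0) ∨
                (∀ z ∈ ball (0:ℂ) 1, BT (ν n) z ≠ 0))
    (hweak : ∀ f : C(Circle, ℝ),
      Tendsto (fun n => ∫ ζ, f ζ ∂(ν n)) atTop (𝓝 (∫ ζ, f ζ ∂νlim))) :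
    (∀ z ∈ ball (0:ℂ) 1, BT νlim z = 0) ∨ (∀ z ∈ ball (0:ℂ) 1, BT νlim z ≠ 0) := by
  have hiff : ∀ (μ : Measure Circle) [IsProbabilityMeasure μ], ∀ z ∈ ball (0:ℂ) 1,
      BT μ z = 0 ↔ chiT μ z = 0 := fun μ _ z hz => BT_eq_zero_iff μ (mem_ball_zero_iff.1 hz)
  have key := eq_zero_or_ne_zero_of_tendstoLocallyUniformlyOn isOpen_ball
    (convex_ball (0 : ℂ) 1).isPreconnected (fun n => differentiableOn_chiT (ν n))
    (tendstoLocallyUniformlyOn_chiT hweak) fun n => (hID n).imp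
      (fun h z hz => (hiff (ν n) z hz).1 (h z hz))
      (fun h z hz => mt (hiff (ν n) z hz).2 (h z hz))
  exact key.imp (fun h z hz => (hiff νlim z hz).2 (h z hz))
    (fun h z hz => mt (hiff νlim z hz).1 (h z hz))

end
end
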